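/- arXiv:2009.03384 — 2 statements merged into one kernel-verified Lean document; each statement's English description precedes it below -/
import Mathlib

section
/- Hölder embedding of the anisotropic Sobolev space H̃¹ in 2D (Lemma 4.9, first embedding, on a box): there exists a constant C > 0, depending only on Q, such that for every u that is twice continuously differentiable on the closure of Q and for all x, y in the closure of Q, |u(x) − u(y)| ≤ C · ( ∫_Q ( u² + (∂u/∂x₁)² + (∂u/∂x₂)² + (∂²u/∂x₁∂x₂)² ) dx )^{1/2} · |x − y|^{1/2}, and moreover sup_{x∈cl(Q)} |u(x)| ≤ C · ( ∫_Q ( u² + (∂u/∂x₁)² + (∂u/∂x₂)² + (∂²u/∂x₁∂x₂)² ) dx )^{1/2}. -/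
open MeasureTheory Finset

/-- The partial derivative `∂u/∂xᵢ` of a function on `ℝ²`. -/
noncomputable def pDeriv2 (u : (Fin 2 → ℝ) → ℝ) (i : Fin 2) (x : Fin 2 → ℝ) : ℝ :=
  fderiv ℝ u x (Pi.single i 1)

/-- The mixed second partial derivative `∂²u/∂x₁∂x₂` of a function on `ℝ²`. -/
noncomputable def mixedDeriv2 (u : (Fin 2 → ℝ) → ℝ) (x : Fin 2 → ℝ) : ℝ :=
  fderiv ℝ (fun y => fderiv ℝ u y (Pi.single 1 1)) x (Pi.single 0 1)

open intervalIntegral in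
lemma aux_cs (g : ℝ → ℝ) (hg : Continuous g) (y x : ℝ) (h : y ≤ x) :
    (∫ s in y..x, g s) ^ 2 ≤ (x - y) * ∫ s in y..x, g s ^ 2 := by
  rcases h.eq_or_lt with rfl | h
  · simp
  set I := ∫ s in y..x, g s with hI
  have h0 : 0 ≤ ∫ s in y..x, ((x - y) * g s - I) ^ 2 :=
    intervalIntegral.integral_nonneg h.le (fun s _ => sq_nonneg _)
  have h1 : ∫ s in y..x, ((x - y) * g s - I) ^ 2
      = (x - y) ^ 2 * (∫ s in y..x, g s ^ 2) - (2 * (x - y) * I) * I + (x - y) * I ^ 2 := by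
    have : ∀ s, ((x - y) * g s - I) ^ 2
        = (x - y) ^ 2 * g s ^ 2 - (2 * (x - y) * I) * g s + I ^ 2 := fun s => by ring
    simp_rw [this]
    rw [intervalIntegral.integral_add, intervalIntegral.integral_sub,
      intervalIntegral.integral_const_mul, intervalIntegral.integral_const_mul,
      intervalIntegral.integral_const, smul_eq_mul]
    all_goals exact Continuous.intervalIntegrable (by fun_prop) _ _
  have h2 : 0 ≤ (x - y) * ((x - y) * (∫ s in y..x, g s ^ 2) - I ^ 2) := by
    rw [h1] at h0; nlinarith
  have := nonneg_of_mul_nonneg_right h2 (by linarith)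
  linarith

lemma aux_holder (α β : ℝ) (f g : ℝ → ℝ) (hf : Continuous f) (hg : Continuous g)
    (hd : ∀ s ∈ Set.Ioo α β, HasDerivAt f (g s) s)
    (x y : ℝ) (hx : x ∈ Set.Icc α β) (hy : y ∈ Set.Icc α β) :
    (f x - f y) ^ 2 ≤ |x - y| * ∫ s in α..β, g s ^ 2 := by
  wlog hxy : y ≤ x generalizing x y
  · have := this y x hy hx (by linarith)
    rw [abs_sub_comm]; nlinarith
  have h1 : ∫ s in y..x, g s = f x - f y :=
    intervalIntegral.integral_eq_sub_of_hasDerivAt_of_le hxy hf.continuousOn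
      (fun s hs => hd s ⟨hy.1.trans_lt hs.1, hs.2.trans_le hx.2⟩) (hg.intervalIntegrable _ _)
  have h2 := aux_cs g hg y x hxy
  rw [h1] at h2
  rw [abs_of_nonneg (by linarith)]
  refine h2.trans (mul_le_mul_of_nonneg_left ?_ (by linarith))
  refine intervalIntegral.integral_mono_interval hy.1 hxy hx.2 ?_
    (Continuous.intervalIntegrable (by fun_prop) _ _)
  exact Filter.Eventually.of_forall fun s => sq_nonneg _

lemma aux_sup (α β : ℝ) (hαβ : α < β) (f g : ℝ → ℝ) (hf : Continuous f) (hg : Continuous g)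
    (hd : ∀ s ∈ Set.Ioo α β, HasDerivAt f (g s) s)
    (x : ℝ) (hx : x ∈ Set.Icc α β) :
    f x ^ 2 ≤ (2 / (β - α) + 2 * (β - α)) * ∫ s in α..β, (f s ^ 2 + g s ^ 2) := by
  have hL : 0 < β - α := by linarith
  set L := β - α with hLdef
  set G := ∫ s in α..β, g s ^ 2 with hG
  have hG0 : 0 ≤ G := intervalIntegral.integral_nonneg hαβ.le (fun s _ => sq_nonneg _)
  have hF0 : 0 ≤ ∫ s in α..β, f s ^ 2 :=
    intervalIntegral.integral_nonneg hαβ.le (fun s _ => sq_nonneg _)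
  have h1 : ∀ t ∈ Set.Icc α β, f x ^ 2 ≤ 2 * f t ^ 2 + 2 * L * G := by
    intro t ht
    have h := aux_holder α β f g hf hg hd x t hx ht
    have h' : |x - t| ≤ L := by
      rw [abs_le]; constructor <;> linarith [hx.1, hx.2, ht.1, ht.2]
    have h'' := mul_le_mul_of_nonneg_right h' hG0
    nlinarith [sq_nonneg (f x - 2 * f t)]
  have h2 : ∫ t in α..β, f x ^ 2 ≤ ∫ t in α..β, (2 * f t ^ 2 + 2 * L * G) :=
    intervalIntegral.integral_mono_on hαβ.le (Continuous.intervalIntegrable (by fun_prop) _ _)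
      (Continuous.intervalIntegrable (by fun_prop) _ _) h1
  rw [intervalIntegral.integral_add (Continuous.intervalIntegrable (by fun_prop) _ _)
    (Continuous.intervalIntegrable (by fun_prop) _ _), intervalIntegral.integral_const_mul,
    intervalIntegral.integral_const, intervalIntegral.integral_const, smul_eq_mul, smul_eq_mul,
    ← hLdef] at h2
  rw [intervalIntegral.integral_add (Continuous.intervalIntegrable (by fun_prop) _ _)
    (Continuous.intervalIntegrable (by fun_prop) _ _), ← hG]
  set F := ∫ s in α..β, f s ^ 2 with hF
  have h3 : f x ^ 2 ≤ 2 / L * F + 2 * L * G := by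
    have : f x ^ 2 = (L * f x ^ 2) / L := by field_simp
    rw [this]
    have : 2 / L * F + 2 * L * G = (2 * F + L * (2 * L * G)) / L := by field_simp
    rw [this]
    gcongr
  have : 0 ≤ 2 / L * G := by positivity
  have : 0 ≤ 2 * L * F := by positivity
  nlinarith

lemma aux_planar (a0 b0 a1 b1 : ℝ) (h0 : a0 < b0) (h1 : a1 < b1) (U U0 U1 M : ℝ → ℝ → ℝ)
    (hU : Continuous fun p : ℝ × ℝ => U p.1 p.2) (hU0 : Continuous fun p : ℝ × ℝ => U0 p.1 p.2)
    (hU1 : Continuous fun p : ℝ × ℝ => U1 p.1 p.2) (hM : Continuous fun p : ℝ × ℝ => M p.1 p.2)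
    (d0 : ∀ t ∈ Set.Icc a1 b1, ∀ s ∈ Set.Ioo a0 b0, HasDerivAt (fun s => U s t) (U0 s t) s)
    (d1 : ∀ s ∈ Set.Icc a0 b0, ∀ t ∈ Set.Ioo a1 b1, HasDerivAt (fun t => U s t) (U1 s t) t)
    (dM : ∀ t ∈ Set.Icc a1 b1, ∀ s ∈ Set.Ioo a0 b0, HasDerivAt (fun s => U1 s t) (M s t) s)
    (N : ℝ) (hN : N = ∫ t in a1..b1, ∫ s in a0..b0,
      (U s t ^ 2 + U0 s t ^ 2 + U1 s t ^ 2 + M s t ^ 2))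
    (c0 c1 : ℝ) (hc0 : c0 = 2 / (b0 - a0) + 2 * (b0 - a0))
    (hc1 : c1 = 2 / (b1 - a1) + 2 * (b1 - a1)) :
    (∀ s ∈ Set.Icc a0 b0, ∀ t ∈ Set.Icc a1 b1, U s t ^ 2 ≤ c1 * c0 * N) ∧
    (∀ x ∈ Set.Icc a0 b0, ∀ y ∈ Set.Icc a0 b0, ∀ t ∈ Set.Icc a1 b1,
      (U x t - U y t) ^ 2 ≤ c1 * |x - y| * N) ∧
    (∀ s ∈ Set.Icc a0 b0, ∀ x ∈ Set.Icc a1 b1, ∀ y ∈ Set.Icc a1 b1,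
      (U s x - U s y) ^ 2 ≤ c0 * |x - y| * N) := by
  have hc0' : 0 < c0 := by rw [hc0]; have : 0 < b0 - a0 := by linarith
                           positivity
  have hc1' : 0 < c1 := by rw [hc1]; have : 0 < b1 - a1 := by linarith
                           positivity
  have cU : ∀ {X : Type} [TopologicalSpace X] (f g : X → ℝ), Continuous f → Continuous g →
      Continuous fun x => U (f x) (g x) := fun f g hf hg => hU.comp (hf.prodMk hg)
  have cU0 : ∀ {X : Type} [TopologicalSpace X] (f g : X → ℝ), Continuous f → Continuous g →
      Continuous fun x => U0 (f x) (g x) := fun f g hf hg => hU0.comp (hf.prodMk hg)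
  have cU1 : ∀ {X : Type} [TopologicalSpace X] (f g : X → ℝ), Continuous f → Continuous g →
      Continuous fun x => U1 (f x) (g x) := fun f g hf hg => hU1.comp (hf.prodMk hg)
  have cM : ∀ {X : Type} [TopologicalSpace X] (f g : X → ℝ), Continuous f → Continuous g →
      Continuous fun x => M (f x) (g x) := fun f g hf hg => hM.comp (hf.prodMk hg)
  set W : ℝ → ℝ → ℝ := fun s t => U s t ^ 2 + U0 s t ^ 2 + U1 s t ^ 2 + M s t ^ 2 with hW
  have hWc : Continuous fun p : ℝ × ℝ => W p.1 p.2 := by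
    simp only [hW]; fun_prop
  have hEc : Continuous fun t => ∫ s in a0..b0, W s t :=
    intervalIntegral.continuous_parametric_intervalIntegral_of_continuous'
      (f := fun t s => W s t) (hWc.comp continuous_swap) a0 b0
  have sl : ∀ (f : ℝ → ℝ → ℝ), (Continuous fun p : ℝ × ℝ => f p.1 p.2) → ∀ t,
      Continuous fun s => f s t := fun f hf t => hf.comp (by fun_prop : Continuous fun s : ℝ => (s, t))
  have sl' : ∀ (f : ℝ → ℝ → ℝ), (Continuous fun p : ℝ × ℝ => f p.1 p.2) → ∀ s,
      Continuous fun t => f s t := fun f hf s => hf.comp (by fun_prop : Continuous fun t : ℝ => (s, t))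
  have inner : ∀ (g : ℝ → ℝ) , Continuous g → ∀ t, (∀ s, g s ≤ W s t) →
      ∫ s in a0..b0, g s ≤ ∫ s in a0..b0, W s t := fun g hg t h =>
    intervalIntegral.integral_mono_on h0.le (hg.intervalIntegrable _ _)
      ((sl W hWc t).intervalIntegrable _ _) (fun s _ => h s)
  have outer : ∀ (g : ℝ → ℝ) (c : ℝ), Continuous g →
      (∀ t ∈ Set.Icc a1 b1, g t ≤ c * ∫ s in a0..b0, W s t) → ∫ t in a1..b1, g t ≤ c * N := by
    intro g c hg h
    rw [hN, ← intervalIntegral.integral_const_mul]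
    exact intervalIntegral.integral_mono_on h1.le (hg.intervalIntegrable _ _)
      ((continuous_const.mul hEc).intervalIntegrable _ _) h
  refine ⟨?_, ?_, ?_⟩
  · intro s hs t ht
    have A := aux_sup a1 b1 h1 (fun t => U s t) (fun t => U1 s t) (sl' U hU s) (sl' U1 hU1 s)
      (d1 s hs) t ht
    rw [← hc1] at A
    refine A.trans ?_
    rw [mul_assoc]
    refine mul_le_mul_of_nonneg_left ?_ hc1'.le
    refine outer _ _ (((sl' U hU s).pow 2).add ((sl' U1 hU1 s).pow 2)) ?_
    intro τ hτ
    have B := aux_sup a0 b0 h0 _ _ (sl U hU τ) (sl U0 hU0 τ) (d0 τ hτ) s hs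
    have B' := aux_sup a0 b0 h0 _ _ (sl U1 hU1 τ) (sl M hM τ) (dM τ hτ) s hs
    rw [← hc0] at B B'
    refine (add_le_add B B').trans (le_of_eq ?_)
    rw [← mul_add, ← intervalIntegral.integral_add]
    · congr 2; ext σ; simp only [hW]; ring
    · exact (((sl U hU τ).pow 2).add ((sl U0 hU0 τ).pow 2)).intervalIntegrable _ _
    · exact (((sl U1 hU1 τ).pow 2).add ((sl M hM τ).pow 2)).intervalIntegrable _ _
  · intro x hx y hy t ht
    have A := aux_sup a1 b1 h1 (fun t => U x t - U y t) (fun t => U1 x t - U1 y t)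
      ((sl' U hU x).sub (sl' U hU y)) ((sl' U1 hU1 x).sub (sl' U1 hU1 y))
      (fun τ hτ => (d1 x hx τ hτ).sub (d1 y hy τ hτ)) t ht
    rw [← hc1] at A
    refine A.trans ?_
    rw [mul_assoc]
    refine mul_le_mul_of_nonneg_left ?_ hc1'.le
    refine outer _ _ ((((sl' U hU x).sub (sl' U hU y)).pow 2).add
      (((sl' U1 hU1 x).sub (sl' U1 hU1 y)).pow 2)) ?_
    intro τ hτ
    have B := aux_holder a0 b0 _ _ (sl U hU τ) (sl U0 hU0 τ) (d0 τ hτ) x y hx hy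
    have B' := aux_holder a0 b0 _ _ (sl U1 hU1 τ) (sl M hM τ) (dM τ hτ) x y hx hy
    refine (add_le_add B B').trans ?_
    rw [← mul_add, ← intervalIntegral.integral_add]
    · refine mul_le_mul_of_nonneg_left ?_ (abs_nonneg _)
      refine inner _ (((sl U0 hU0 τ).pow 2).add ((sl M hM τ).pow 2)) τ ?_
      intro s; simp only [hW, Pi.add_apply, Pi.pow_apply]; nlinarith [sq_nonneg (U s τ), sq_nonneg (U1 s τ)]
    · exact ((sl U0 hU0 τ).pow 2).intervalIntegrable _ _
    · exact ((sl M hM τ).pow 2).intervalIntegrable _ _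
  · intro s hs x hx y hy
    have A := aux_holder a1 b1 _ _ (sl' U hU s) (sl' U1 hU1 s) (d1 s hs) x y hx hy
    refine A.trans ?_
    rw [mul_comm c0, mul_assoc]
    refine mul_le_mul_of_nonneg_left ?_ (abs_nonneg _)
    refine outer _ _ ((sl' U1 hU1 s).pow 2) ?_
    intro τ hτ
    have B' := aux_sup a0 b0 h0 _ _ (sl U1 hU1 τ) (sl M hM τ) (dM τ hτ) s hs
    rw [← hc0] at B'
    refine B'.trans (mul_le_mul_of_nonneg_left ?_ hc0'.le)
    refine inner _ (((sl U1 hU1 τ).pow 2).add ((sl M hM τ).pow 2)) τ ?_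
    intro s; simp only [hW, Pi.add_apply, Pi.pow_apply]; nlinarith [sq_nonneg (U s τ), sq_nonneg (U0 s τ)]

/-- clamp to an interval -/
noncomputable def clampR (α β s : ℝ) : ℝ := max α (min β s)

lemma clampR_cont (α β : ℝ) : Continuous (clampR α β) := by
  unfold clampR; fun_prop

lemma clampR_mem {α β : ℝ} (h : α ≤ β) (s : ℝ) : clampR α β s ∈ Set.Icc α β :=
  ⟨le_max_left _ _, max_le h (min_le_left _ _)⟩

lemma clampR_eq {α β s : ℝ} (h : s ∈ Set.Icc α β) : clampR α β s = s := by
  unfold clampR; rw [min_eq_right h.2, max_eq_right h.1]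

/-- clamped function of two variables -/
noncomputable def clampF (a b : Fin 2 → ℝ) (v : (Fin 2 → ℝ) → ℝ) (s t : ℝ) : ℝ :=
  v ![clampR (a 0) (b 0) s, clampR (a 1) (b 1) t]

lemma mem_box {a b : Fin 2 → ℝ} {s t : ℝ} (hs : s ∈ Set.Icc (a 0) (b 0))
    (ht : t ∈ Set.Icc (a 1) (b 1)) : ![s, t] ∈ Set.Icc a b := by
  constructor <;> intro i <;> fin_cases i <;> simp [hs.1, hs.2, ht.1, ht.2]

lemma clampF_cont {a b : Fin 2 → ℝ} (hab : ∀ i, a i < b i) {v : (Fin 2 → ℝ) → ℝ}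
    (hv : ContinuousOn v (Set.Icc a b)) :
    Continuous fun p : ℝ × ℝ => clampF a b v p.1 p.2 := by
  unfold clampF
  refine hv.comp_continuous ?_ ?_
  · refine continuous_pi fun i => ?_
    fin_cases i
    · exact (clampR_cont _ _).comp continuous_fst
    · exact (clampR_cont _ _).comp continuous_snd
  · intro p
    exact mem_box (clampR_mem (hab 0).le _) (clampR_mem (hab 1).le _)

lemma clampF_eq {a b : Fin 2 → ℝ} (v : (Fin 2 → ℝ) → ℝ) {s t : ℝ} (hs : s ∈ Set.Icc (a 0) (b 0))
    (ht : t ∈ Set.Icc (a 1) (b 1)) : clampF a b v s t = v ![s, t] := by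
  unfold clampF; rw [clampR_eq hs, clampR_eq ht]

lemma clampF_d0 {a b : Fin 2 → ℝ} {v : (Fin 2 → ℝ) → ℝ}
    (hv : DifferentiableOn ℝ v (Set.Icc a b)) (t : ℝ) (ht : t ∈ Set.Icc (a 1) (b 1))
    (s : ℝ) (hs : s ∈ Set.Ioo (a 0) (b 0)) :
    HasDerivAt (fun s => clampF a b v s t)
      (clampF a b (fun w => fderivWithin ℝ v (Set.Icc a b) w (Pi.single 0 1)) s t) s := by
  have hs' := Set.Ioo_subset_Icc_self hs
  rw [clampF_eq _ hs' ht]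
  have h1 : HasFDerivWithinAt v (fderivWithin ℝ v (Set.Icc a b) ![s, t]) (Set.Icc a b) ![s, t] :=
    (hv _ (mem_box hs' ht)).hasFDerivWithinAt
  have h2 : HasDerivAt (fun s : ℝ => ![s, t]) (Pi.single 0 1 : Fin 2 → ℝ) s := by
    rw [hasDerivAt_pi]
    intro i
    fin_cases i
    · simpa using hasDerivAt_id' s
    · simpa using hasDerivAt_const s t
  have h3 := h1.comp_hasDerivWithinAt (t := Set.Icc a b) (s := Set.Icc (a 0) (b 0)) s
    h2.hasDerivWithinAt (fun σ hσ => mem_box hσ ht)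
  refine (h3.congr (fun σ hσ => ?_) ?_).hasDerivAt (Icc_mem_nhds hs.1 hs.2)
  · simp [clampF_eq v hσ ht]
  · simp [clampF_eq v hs' ht]

lemma clampF_d1 {a b : Fin 2 → ℝ} {v : (Fin 2 → ℝ) → ℝ}
    (hv : DifferentiableOn ℝ v (Set.Icc a b)) (s : ℝ) (hs : s ∈ Set.Icc (a 0) (b 0))
    (t : ℝ) (ht : t ∈ Set.Ioo (a 1) (b 1)) :
    HasDerivAt (fun t => clampF a b v s t)
      (clampF a b (fun w => fderivWithin ℝ v (Set.Icc a b) w (Pi.single 1 1)) s t) t := by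
  have ht' := Set.Ioo_subset_Icc_self ht
  rw [clampF_eq _ hs ht']
  have h1 : HasFDerivWithinAt v (fderivWithin ℝ v (Set.Icc a b) ![s, t]) (Set.Icc a b) ![s, t] :=
    (hv _ (mem_box hs ht')).hasFDerivWithinAt
  have h2 : HasDerivAt (fun t : ℝ => ![s, t]) (Pi.single 1 1 : Fin 2 → ℝ) t := by
    rw [hasDerivAt_pi]
    intro i
    fin_cases i
    · simpa using hasDerivAt_const t s
    · simpa using hasDerivAt_id' t
  have h3 := h1.comp_hasDerivWithinAt (t := Set.Icc a b) (s := Set.Icc (a 1) (b 1)) t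
    h2.hasDerivWithinAt (fun σ hσ => mem_box hs hσ)
  refine (h3.congr (fun σ hσ => ?_) ?_).hasDerivAt (Icc_mem_nhds ht.1 ht.2)
  · simp [clampF_eq v hs hσ]
  · simp [clampF_eq v hs ht']

lemma integral_box {a b : Fin 2 → ℝ} (hab : ∀ i, a i < b i) (f : (Fin 2 → ℝ) → ℝ)
    (W : ℝ → ℝ → ℝ) (hW : Continuous fun p : ℝ × ℝ => W p.1 p.2)
    (h : ∀ w ∈ Set.univ.pi fun i => Set.Ioo (a i) (b i), f w = W (w 0) (w 1)) :
    ∫ w in Set.univ.pi fun i => Set.Ioo (a i) (b i), f w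
      = ∫ t in (a 1)..(b 1), ∫ s in (a 0)..(b 0), W s t := by
  have hm : MeasurableSet (Set.univ.pi fun i => Set.Ioo (a i) (b i)) :=
    MeasurableSet.univ_pi fun i => measurableSet_Ioo
  rw [setIntegral_congr_fun hm h]
  have hpre : (Set.univ.pi fun i => Set.Ioo (a i) (b i))
      = (MeasurableEquiv.finTwoArrow (α := ℝ)) ⁻¹'
        (Set.Ioo (a 0) (b 0) ×ˢ Set.Ioo (a 1) (b 1)) := by
    ext w; simp [MeasurableEquiv.finTwoArrow, Set.mem_pi, Fin.forall_fin_two]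
  rw [hpre]
  have := (volume_preserving_finTwoArrow ℝ).setIntegral_preimage_emb
    (MeasurableEquiv.measurableEmbedding _) (fun p : ℝ × ℝ => W p.1 p.2)
    (Set.Ioo (a 0) (b 0) ×ˢ Set.Ioo (a 1) (b 1))
  refine Eq.trans ?_ (this.trans ?_)
  · rfl
  have hint : IntegrableOn (fun p : ℝ × ℝ => W p.1 p.2)
      (Set.Ioo (a 0) (b 0) ×ˢ Set.Ioo (a 1) (b 1)) := by
    refine IntegrableOn.mono_set (t := Set.Icc (a 0) (b 0) ×ˢ Set.Icc (a 1) (b 1)) ?_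
      (Set.prod_mono Set.Ioo_subset_Icc_self Set.Ioo_subset_Icc_self)
    exact hW.continuousOn.integrableOn_compact (isCompact_Icc.prod isCompact_Icc)
  rw [Measure.volume_eq_prod] at hint ⊢
  rw [IntegrableOn, ← Measure.prod_restrict] at hint
  rw [← Measure.prod_restrict, integral_prod_symm _ hint]
  rw [intervalIntegral.integral_of_le (hab 1).le, integral_Ioc_eq_integral_Ioo]
  congr 1; ext t
  rw [intervalIntegral.integral_of_le (hab 0).le, integral_Ioc_eq_integral_Ioo]

/-- **Hölder embedding of the anisotropic Sobolev space `H̃¹` in 2D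
(Lemma 4.9, first embedding, on a box):** there exists `C > 0` depending only on the
rectangle `Q` such that every `u ∈ C²(cl Q)` satisfies
`|u(x) − u(y)| ≤ C ‖u‖_{H̃¹(Q)} |x−y|^{1/2}` on `cl Q` and
`sup_{cl Q} |u| ≤ C ‖u‖_{H̃¹(Q)}`. -/
theorem holder_embedding_tildeH1_2D
    (a b : Fin 2 → ℝ) (hab : ∀ i, a i < b i)
    (Q : Set (Fin 2 → ℝ)) (hQ : Q = Set.univ.pi fun i => Set.Ioo (a i) (b i)) :
    ∃ C : ℝ, 0 < C ∧ ∀ u : (Fin 2 → ℝ) → ℝ, ContDiffOn ℝ 2 u (closure Q) →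
      (∀ x ∈ closure Q, ∀ y ∈ closure Q,
        |u x - u y|
          ≤ C * Real.sqrt (∫ w in Q,
                (u w ^ 2 + pDeriv2 u 0 w ^ 2 + pDeriv2 u 1 w ^ 2 + mixedDeriv2 u w ^ 2))
            * Real.sqrt (Real.sqrt (∑ i, (x i - y i) ^ 2)))
      ∧ ∀ x ∈ closure Q,
          |u x| ≤ C * Real.sqrt (∫ w in Q,
            (u w ^ 2 + pDeriv2 u 0 w ^ 2 + pDeriv2 u 1 w ^ 2 + mixedDeriv2 u w ^ 2)) := by
  have hcl : closure Q = Set.Icc a b := by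
    rw [hQ, closure_pi_set]
    simp_rw [closure_Ioo (hab _).ne]
    exact Set.pi_univ_Icc a b
  have hQo : IsOpen Q := by
    rw [hQ]; exact isOpen_set_pi Set.finite_univ fun i _ => isOpen_Ioo
  have hQK : Q ⊆ Set.Icc a b := hcl ▸ subset_closure
  rw [hcl]
  set c0 := 2 / (b 0 - a 0) + 2 * (b 0 - a 0) with hc0
  set c1 := 2 / (b 1 - a 1) + 2 * (b 1 - a 1) with hc1
  have p0 : 0 < b 0 - a 0 := sub_pos.2 (hab 0)
  have p1 : 0 < b 1 - a 1 := sub_pos.2 (hab 1)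
  have hc0' : 0 < c0 := by positivity
  have hc1' : 0 < c1 := by positivity
  refine ⟨Real.sqrt (c1 * c0 + 2 * (c0 + c1)), by positivity, fun u hu => ?_⟩
  set K := Set.Icc a b with hK
  have hKu : UniqueDiffOn ℝ K := by
    refine uniqueDiffOn_convex (convex_Icc a b) ?_
    refine Set.Nonempty.mono (interior_maximal hQK hQo) ?_
    rw [hQ]
    exact Set.univ_pi_nonempty_iff.2 fun i => Set.nonempty_Ioo.2 (hab i)
  have hf1 : ContDiffOn ℝ 1 (fderivWithin ℝ u K) K := hu.fderivWithin hKu (by norm_num)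
  have hu1 : ∀ e : Fin 2 → ℝ, ContDiffOn ℝ 1 (fun w => fderivWithin ℝ u K w e) K :=
    fun e => hf1.clm_apply contDiffOn_const
  set v := fun w => fderivWithin ℝ u K w (Pi.single 1 1) with hv
  have hM : ContinuousOn (fun w => fderivWithin ℝ v K w (Pi.single 0 1)) K :=
    ((hu1 (Pi.single 1 1)).continuousOn_fderivWithin hKu le_rfl).clm_apply continuousOn_const
  have cU := clampF_cont hab hu.continuousOn
  have cU0 := clampF_cont hab (hu1 (Pi.single 0 1)).continuousOn
  have cU1 := clampF_cont hab (hu1 (Pi.single 1 1)).continuousOn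
  have cM := clampF_cont hab hM
  have hint := integral_box hab
    (fun w => u w ^ 2 + pDeriv2 u 0 w ^ 2 + pDeriv2 u 1 w ^ 2 + mixedDeriv2 u w ^ 2)
    (fun s t => clampF a b u s t ^ 2
      + clampF a b (fun w => fderivWithin ℝ u K w (Pi.single 0 1)) s t ^ 2
      + clampF a b v s t ^ 2
      + clampF a b (fun w => fderivWithin ℝ v K w (Pi.single 0 1)) s t ^ 2)
    ((((cU.pow 2).add (cU0.pow 2)).add (cU1.pow 2)).add (cM.pow 2)) (by
      intro w hw
      have hwQ : w ∈ Q := hQ ▸ hw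
      have hw0 := Set.Ioo_subset_Icc_self (hw 0 trivial)
      have hw1 := Set.Ioo_subset_Icc_self (hw 1 trivial)
      have hww : ![w 0, w 1] = w := by ext i; fin_cases i <;> rfl
      have e : ∀ (f : (Fin 2 → ℝ) → ℝ), ∀ z ∈ Q, fderiv ℝ f z = fderivWithin ℝ f K z :=
        fun f z hz => (fderivWithin_of_mem_nhds
          (Filter.mem_of_superset (hQo.mem_nhds hz) hQK)).symm
      simp only [clampF_eq _ hw0 hw1, hww]
      have e1 : mixedDeriv2 u w = fderivWithin ℝ v K w (Pi.single 0 1) := by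
        unfold mixedDeriv2
        rw [← e v w hwQ]
        congr 1
        refine Filter.EventuallyEq.fderiv_eq ?_
        filter_upwards [hQo.mem_nhds hwQ] with z hz
        rw [e u z hz]
      rw [e1]
      simp only [pDeriv2, e u w hwQ, hv])
  rw [← hQ] at hint
  obtain ⟨A, B0, B1⟩ := aux_planar (a 0) (b 0) (a 1) (b 1) (hab 0) (hab 1) _ _ _ _ cU cU0 cU1 cM
    (clampF_d0 (hu.differentiableOn (by norm_num)))
    (clampF_d1 (hu.differentiableOn (by norm_num)))
    (clampF_d0 ((hu1 (Pi.single 1 1)).differentiableOn (by norm_num))) _ hint c0 c1 hc0 hc1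
  set N := ∫ w in Q, (u w ^ 2 + pDeriv2 u 0 w ^ 2 + pDeriv2 u 1 w ^ 2 + mixedDeriv2 u w ^ 2)
    with hN
  have hN0 : 0 ≤ N := integral_nonneg fun w => by positivity
  have hx0 : ∀ x ∈ K, ∀ i, x i ∈ Set.Icc (a i) (b i) := fun x hx i => ⟨hx.1 i, hx.2 i⟩
  have hww : ∀ w : Fin 2 → ℝ, ![w 0, w 1] = w := fun w => by ext i; fin_cases i <;> rfl
  constructor
  · intro x hx y hy
    set D := Real.sqrt (∑ i, (x i - y i) ^ 2) with hD
    have hD0 : 0 ≤ D := Real.sqrt_nonneg _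
    have hDi : ∀ i, |x i - y i| ≤ D := fun i => by
      refine Real.abs_le_sqrt ?_
      exact Finset.single_le_sum (f := fun i => (x i - y i) ^ 2)
        (fun _ _ => sq_nonneg _) (Finset.mem_univ i)
    have H0 := B0 (x 0) (hx0 x hx 0) (y 0) (hx0 y hy 0) (x 1) (hx0 x hx 1)
    have H1 := B1 (y 0) (hx0 y hy 0) (x 1) (hx0 x hx 1) (y 1) (hx0 y hy 1)
    rw [clampF_eq _ (hx0 x hx 0) (hx0 x hx 1), clampF_eq _ (hx0 y hy 0) (hx0 x hx 1),
      hww] at H0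
    rw [clampF_eq _ (hx0 y hy 0) (hx0 x hx 1), clampF_eq _ (hx0 y hy 0) (hx0 y hy 1),
      hww] at H1
    have H0' : c1 * |x 0 - y 0| * N ≤ c1 * D * N := by gcongr; exact hDi 0
    have H1' : c0 * |x 1 - y 1| * N ≤ c0 * D * N := by gcongr; exact hDi 1
    rw [← Real.sqrt_mul (by positivity), ← Real.sqrt_mul (by positivity)]
    refine Real.abs_le_sqrt ?_
    have : 0 ≤ c1 * c0 * N * D := by positivity
    set z := u ![y 0, x 1]
    nlinarith [sq_nonneg ((u x - z) - (z - u y))]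
  · intro x hx
    have H := A (x 0) (hx0 x hx 0) (x 1) (hx0 x hx 1)
    rw [clampF_eq _ (hx0 x hx 0) (hx0 x hx 1), hww] at H
    rw [← Real.sqrt_mul (by positivity)]
    refine Real.abs_le_sqrt (H.trans ?_)
    gcongr
    linarith
end

section
/- Hölder embedding of the anisotropic Sobolev space H̃¹ in 3D (Lemma 4.9, first embedding, on a box): there exists a constant C > 0, depending only on Q, such that for every u that is three times continuously differentiable on the closure of Q and for all x, y in the closure of Q, |u(x) − u(y)| ≤ C · N(u) · |x − y|^{1/2}, and sup_{x∈cl(Q)} |u(x)| ≤ C · N(u), where N(u) = ( ∫_Q ( u² + Σ_{i=1}^3 (∂u/∂xᵢ)² + Σ_{1≤i<j≤3} (∂²u/∂xᵢ∂x_j)² + (∂³u/∂x₁∂x₂∂x₃)² ) dx )^{1/2}. -/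
open MeasureTheory Finset

/-- The partial derivative `∂u/∂xᵢ` of a function on `ℝ³`. -/
noncomputable def pDeriv3 (u : (Fin 3 → ℝ) → ℝ) (i : Fin 3) (x : Fin 3 → ℝ) : ℝ :=
  fderiv ℝ u x (Pi.single i 1)

/-- The second partial derivative `∂²u/∂xᵢ∂x_j` of a function on `ℝ³`. -/
noncomputable def pDeriv3₂ (u : (Fin 3 → ℝ) → ℝ) (i j : Fin 3) (x : Fin 3 → ℝ) : ℝ :=
  fderiv ℝ (fun y => fderiv ℝ u y (Pi.single j 1)) x (Pi.single i 1)

/-- The mixed third partial derivative `∂³u/∂x₁∂x₂∂x₃` of a function on `ℝ³`. -/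
noncomputable def mixedDeriv3 (u : (Fin 3 → ℝ) → ℝ) (x : Fin 3 → ℝ) : ℝ :=
  fderiv ℝ (fun y => fderiv ℝ (fun w => fderiv ℝ u w (Pi.single 2 1)) y (Pi.single 1 1))
    x (Pi.single 0 1)

/-- The squared `H̃¹(Q)`-integrand
`u² + Σᵢ(∂u/∂xᵢ)² + Σ_{i<j}(∂²u/∂xᵢ∂x_j)² + (∂³u/∂x₁∂x₂∂x₃)²`. -/
noncomputable def tildeH1Integrand3 (u : (Fin 3 → ℝ) → ℝ) (w : Fin 3 → ℝ) : ℝ :=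
  u w ^ 2 + ∑ i, pDeriv3 u i w ^ 2
    + (pDeriv3₂ u 0 1 w ^ 2 + pDeriv3₂ u 0 2 w ^ 2 + pDeriv3₂ u 1 2 w ^ 2)
    + mixedDeriv3 u w ^ 2

lemma cs_real (f : ℝ → ℝ) (s t : ℝ) (hst : s < t) (hf : ContinuousOn f (Set.Icc s t)) :
    (∫ r in s..t, f r) ^ 2 ≤ (t - s) * ∫ r in s..t, f r ^ 2 := by
  set I := ∫ r in s..t, f r with hI
  have h1 : IntervalIntegrable f volume s t := hf.intervalIntegrable_of_Icc hst.le
  have h2 : IntervalIntegrable (fun r => f r ^ 2) volume s t :=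
    (hf.pow 2).intervalIntegrable_of_Icc hst.le
  have h0 : 0 ≤ ∫ r in s..t, ((t - s) * f r - I) ^ 2 :=
    intervalIntegral.integral_nonneg hst.le (fun _ _ => sq_nonneg _)
  have e : ∀ r, ((t - s) * f r - I) ^ 2 = ((t-s)^2 * f r ^ 2 - (2 * (t - s) * I) * f r) + I ^ 2 := by
    intro r; ring
  simp_rw [e] at h0
  rw [intervalIntegral.integral_add ((h2.const_mul _).sub (h1.const_mul _)) (by simp),
    intervalIntegral.integral_sub (h2.const_mul _) (h1.const_mul _),
    intervalIntegral.integral_const_mul, intervalIntegral.integral_const_mul, ← hI] at h0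
  simp only [intervalIntegral.integral_const, smul_eq_mul] at h0
  have hp : 0 < t - s := by linarith
  have : 0 ≤ (t - s) * ((t - s) * (∫ r in s..t, f r ^ 2) - I ^ 2) := by nlinarith
  have := nonneg_of_mul_nonneg_right this hp
  linarith

lemma lemB' (g g' : ℝ → ℝ) (α β s t : ℝ) (hs : s ∈ Set.Ioo α β) (ht : t ∈ Set.Ioo α β)
    (hd : ∀ r ∈ Set.Ioo α β, HasDerivAt g (g' r) r) (hc : ContinuousOn g' (Set.Ioo α β))
    (hst : s < t) :
    ENNReal.ofReal ((g t - g s) ^ 2) ≤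
      ENNReal.ofReal (t - s) * ∫⁻ r in Set.Ioo α β, ENNReal.ofReal (g' r ^ 2) := by
  have hsub : Set.Icc s t ⊆ Set.Ioo α β := fun r hr => ⟨hs.1.trans_le hr.1, hr.2.trans_lt ht.2⟩
  have hc' := hc.mono hsub
  have h1 : IntervalIntegrable g' volume s t := hc'.intervalIntegrable_of_Icc hst.le
  have ftc := intervalIntegral.integral_eq_sub_of_hasDerivAt (a := s) (b := t) (f := g) (f' := g')
    (fun r hr => hd r (hsub (by rwa [Set.uIcc_of_le hst.le] at hr))) h1
  rw [← ftc]
  refine (ENNReal.ofReal_le_ofReal (cs_real g' s t hst hc')).trans ?_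
  rw [ENNReal.ofReal_mul (by linarith)]
  gcongr
  rw [intervalIntegral.integral_of_le hst.le, ofReal_integral_eq_lintegral_ofReal]
  · exact lintegral_mono_set (Set.Ioc_subset_Icc_self.trans hsub)
  · exact ((hc'.pow 2).intervalIntegrable_of_Icc hst.le).1
  · exact Filter.Eventually.of_forall (fun _ => sq_nonneg _)

lemma lemB (g g' : ℝ → ℝ) (α β s t : ℝ) (hs : s ∈ Set.Ioo α β) (ht : t ∈ Set.Ioo α β)
    (hd : ∀ r ∈ Set.Ioo α β, HasDerivAt g (g' r) r) (hc : ContinuousOn g' (Set.Ioo α β)) :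
    ENNReal.ofReal ((g t - g s) ^ 2) ≤
      ENNReal.ofReal |t - s| * ∫⁻ r in Set.Ioo α β, ENNReal.ofReal (g' r ^ 2) := by
  rcases lt_trichotomy s t with h | h | h
  · rw [abs_of_pos (by linarith)]
    exact lemB' g g' α β s t hs ht hd hc h
  · simp [h]
  · rw [abs_of_neg (by linarith), neg_sub, show (g t - g s) ^ 2 = (g s - g t) ^ 2 by ring]
    exact lemB' g g' α β t s ht hs hd hc h

lemma lemA (g g' : ℝ → ℝ) (α β t : ℝ) (ht : t ∈ Set.Ioo α β)
    (hd : ∀ r ∈ Set.Ioo α β, HasDerivAt g (g' r) r) (hc : ContinuousOn g' (Set.Ioo α β)) :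
    ENNReal.ofReal (g t ^ 2) ≤
      ENNReal.ofReal (2 / (β - α) + 2 * (β - α)) *
        ∫⁻ r in Set.Ioo α β, (ENNReal.ofReal (g r ^ 2) + ENNReal.ofReal (g' r ^ 2)) := by
  have hp : 0 < β - α := by linarith [ht.1, ht.2]
  have hgc : ContinuousOn g (Set.Ioo α β) := fun r hr => (hd r hr).continuousAt.continuousWithinAt
  set J := ∫⁻ r in Set.Ioo α β, ENNReal.ofReal (g' r ^ 2) with hJ
  set I := ∫⁻ r in Set.Ioo α β, ENNReal.ofReal (g r ^ 2) with hI
  have key : ∀ s ∈ Set.Ioo α β, ENNReal.ofReal (g t ^ 2) ≤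
      2 * ENNReal.ofReal (g s ^ 2) + 2 * (ENNReal.ofReal (β - α) * J) := by
    intro s hs
    have h1 := lemB g g' α β s t hs ht hd hc
    have h2 : ENNReal.ofReal (g t ^ 2) ≤
        2 * ENNReal.ofReal (g s ^ 2) + 2 * ENNReal.ofReal ((g t - g s) ^ 2) := by
      rw [← ENNReal.ofReal_ofNat 2, ← ENNReal.ofReal_mul (by norm_num),
        ← ENNReal.ofReal_mul (by norm_num), ← ENNReal.ofReal_add (by positivity) (by positivity)]
      apply ENNReal.ofReal_le_ofReal
      nlinarith [sq_nonneg (g t - 2 * g s)]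
    refine h2.trans ?_
    gcongr
    refine h1.trans ?_
    gcongr
    rw [abs_le]; constructor <;> linarith [hs.1, hs.2, ht.1, ht.2]
  have h3 : ∫⁻ s in Set.Ioo α β, ENNReal.ofReal (g t ^ 2) ≤
      ∫⁻ s in Set.Ioo α β, (2 * ENNReal.ofReal (g s ^ 2) + 2 * (ENNReal.ofReal (β - α) * J)) :=
    setLIntegral_mono' measurableSet_Ioo key
  have hm : AEMeasurable (fun s => ENNReal.ofReal (g s ^ 2)) (volume.restrict (Set.Ioo α β)) :=
    ((hgc.pow 2).aemeasurable measurableSet_Ioo).ennreal_ofReal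
  rw [lintegral_add_right _ measurable_const, lintegral_const_mul' _ _ (by simp), lintegral_const,
    lintegral_const] at h3
  rw [lintegral_add_left' hm, ← hI, ← hJ]
  rw [← hI] at h3
  simp only [Measure.restrict_apply MeasurableSet.univ, Set.univ_inter, Real.volume_Ioo] at h3
  set L := ENNReal.ofReal (β - α) with hL
  have hL0 : L ≠ 0 := by simpa [hL] using hp
  have hLt : L ≠ ⊤ := by simp [hL]
  have hc : ENNReal.ofReal (2 / (β - α) + 2 * (β - α)) = 2 / L + 2 * L := by
    rw [ENNReal.ofReal_add (by positivity) (by positivity), ENNReal.ofReal_div_of_pos hp,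
      ENNReal.ofReal_mul (by norm_num)]
    simp [hL]
  rw [hc, ← ENNReal.mul_le_mul_iff_left hL0 hLt]
  refine h3.trans ?_
  calc 2 * I + 2 * (L * J) * L ≤ (2 + 2 * L * L) * (I + J) := by
        rw [add_mul]
        have e : 2 * (L * J) * L = 2 * L * L * J := by ring
        rw [e]
        gcongr <;> simp
    _ = (2 / L * L + 2 * L * L) * (I + J) := by rw [ENNReal.div_mul_cancel hL0 hLt]
    _ = _ := by ring
  

/-- The open box. -/
def boxQ (a b : Fin 3 → ℝ) : Set (Fin 3 → ℝ) := Set.univ.pi fun i => Set.Ioo (a i) (b i)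

lemma boxQ_open (a b : Fin 3 → ℝ) : IsOpen (boxQ a b) :=
  isOpen_set_pi Set.finite_univ (fun _ _ => isOpen_Ioo)

lemma boxQ_closure (a b : Fin 3 → ℝ) (hab : ∀ i, a i < b i) :
    closure (boxQ a b) = Set.univ.pi fun i => Set.Icc (a i) (b i) := by
  rw [boxQ, closure_pi_set]
  congr 1
  ext1 i
  exact closure_Ioo (hab i).ne

/-- `f` agrees on the open box with a `C^n` function on the closed box. -/
def PP (a b : Fin 3 → ℝ) (n : ℕ) (f : (Fin 3 → ℝ) → ℝ) : Prop :=
  ∃ g, ContDiffOn ℝ n g (closure (boxQ a b)) ∧ Set.EqOn f g (boxQ a b)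

lemma pDeriv3_congr {a b : Fin 3 → ℝ} {f g : (Fin 3 → ℝ) → ℝ} (h : Set.EqOn f g (boxQ a b))
    (i : Fin 3) : Set.EqOn (pDeriv3 f i) (pDeriv3 g i) (boxQ a b) := by
  intro x hx
  have : f =ᶠ[nhds x] g := h.eventuallyEq_of_mem ((boxQ_open a b).mem_nhds hx)
  simp only [pDeriv3, this.fderiv_eq]

lemma PP.contDiffOn {a b : Fin 3 → ℝ} {n : ℕ} {f : (Fin 3 → ℝ) → ℝ} (h : PP a b n f) :
    ContDiffOn ℝ n f (boxQ a b) := by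
  obtain ⟨g, hg, e⟩ := h
  exact (hg.mono subset_closure).congr e

lemma PP.mono {a b : Fin 3 → ℝ} {n m : ℕ} {f : (Fin 3 → ℝ) → ℝ} (h : PP a b n f) (hm : m ≤ n) :
    PP a b m f := by
  obtain ⟨g, hg, e⟩ := h
  exact ⟨g, hg.of_le (by exact_mod_cast hm), e⟩

lemma PP.deriv {a b : Fin 3 → ℝ} (hab : ∀ i, a i < b i) {n : ℕ} {f : (Fin 3 → ℝ) → ℝ}
    (h : PP a b (n + 1) f) (i : Fin 3) : PP a b n (pDeriv3 f i) := by
  obtain ⟨g, hg, e⟩ := h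
  have hu : UniqueDiffOn ℝ (closure (boxQ a b)) := by
    rw [boxQ_closure a b hab]
    exact UniqueDiffOn.univ_pi (fun i => uniqueDiffOn_Icc (hab i))
  refine ⟨fun x => fderivWithin ℝ g (closure (boxQ a b)) x (Pi.single i 1), ?_, ?_⟩
  · exact (hg.fderivWithin hu (by norm_cast)).clm_apply contDiffOn_const
  · intro x hx
    rw [pDeriv3_congr e i hx]
    simp only [pDeriv3]
    rw [fderivWithin_of_mem_nhds]
    exact Filter.mem_of_superset ((boxQ_open a b).mem_nhds hx) subset_closure

lemma PP.integrable {a b : Fin 3 → ℝ} (hab : ∀ i, a i < b i) {n : ℕ} {f : (Fin 3 → ℝ) → ℝ}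
    (h : PP a b n f) : IntegrableOn (fun x => f x ^ 2) (boxQ a b) := by
  obtain ⟨g, hg, e⟩ := h
  have hk : IsCompact (closure (boxQ a b)) := by
    rw [boxQ_closure a b hab]
    exact isCompact_univ_pi (fun i => isCompact_Icc)
  have h1 : IntegrableOn (fun x => g x ^ 2) (boxQ a b) :=
    ((hg.continuousOn.pow 2).integrableOn_compact hk).mono_set subset_closure
  exact h1.congr_fun (fun x hx => by simp only [e hx]) (boxQ_open a b).measurableSet

lemma PP.symm {a b : Fin 3 → ℝ} {f : (Fin 3 → ℝ) → ℝ}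
    (h : PP a b 2 f) (i j : Fin 3) :
    Set.EqOn (pDeriv3 (pDeriv3 f i) j) (pDeriv3 (pDeriv3 f j) i) (boxQ a b) := by
  intro x hx
  have hc : ContDiffAt ℝ 2 f x := h.contDiffOn.contDiffAt ((boxQ_open a b).mem_nhds hx)
  have hs := hc.isSymmSndFDerivAt (by simp)
  have hd : DifferentiableAt ℝ (fderiv ℝ f) x :=
    (hc.fderiv_right (m := 1) (by norm_num)).differentiableAt (by norm_num)
  have key : ∀ v w : Fin 3 → ℝ, fderiv ℝ (fun y => fderiv ℝ f y v) x w
      = fderiv ℝ (fderiv ℝ f) x w v := by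
    intro v w
    rw [fderiv_clm_apply hd (differentiableAt_const v)]
    simp
  have := hs (Pi.single i 1) (Pi.single j 1)
  simp only [pDeriv3] at *
  have k1 := key (Pi.single i 1) (Pi.single j 1)
  have k2 := key (Pi.single j 1) (Pi.single i 1)
  rw [← k1, ← k2] at this
  exact this.symm

open Classical in
/-- The squared function, extended by zero. -/
noncomputable def GG (a b : Fin 3 → ℝ) (f : (Fin 3 → ℝ) → ℝ) : (Fin 3 → ℝ) → ENNReal :=
  fun x => ENNReal.ofReal ((boxQ a b).piecewise (fun x => f x ^ 2) 0 x)

lemma GG_mem {a b : Fin 3 → ℝ} (f : (Fin 3 → ℝ) → ℝ) {x : Fin 3 → ℝ} (hx : x ∈ boxQ a b) :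
    GG a b f x = ENNReal.ofReal (f x ^ 2) := by
  simp [GG, hx]

lemma GG_notMem {a b : Fin 3 → ℝ} (f : (Fin 3 → ℝ) → ℝ) {x : Fin 3 → ℝ} (hx : x ∉ boxQ a b) :
    GG a b f x = 0 := by
  simp [GG, hx]

lemma GG_congr {a b : Fin 3 → ℝ} {f g : (Fin 3 → ℝ) → ℝ} (h : Set.EqOn f g (boxQ a b)) :
    GG a b f = GG a b g := by
  ext1 x
  by_cases hx : x ∈ boxQ a b
  · rw [GG_mem f hx, GG_mem g hx, h hx]
  · rw [GG_notMem f hx, GG_notMem g hx]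

lemma GG_meas {a b : Fin 3 → ℝ} {n : ℕ} {f : (Fin 3 → ℝ) → ℝ} (h : PP a b n f) :
    Measurable (GG a b f) := by
  classical
  unfold GG
  apply Measurable.ennreal_ofReal
  exact ContinuousOn.measurable_piecewise (h.contDiffOn.continuousOn.pow 2)
    continuous_zero.continuousOn (boxQ_open a b).measurableSet

/-- One-dimensional measures. -/
noncomputable def mu (a b : Fin 3 → ℝ) : (i : Fin 3) → Measure ℝ :=
  fun i => volume.restrict (Set.Ioo (a i) (b i))

instance (a b : Fin 3 → ℝ) (i : Fin 3) : SigmaFinite (mu a b i) := by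
  unfold mu; infer_instance

lemma update_mem {a b x : Fin 3 → ℝ} (hx : x ∈ boxQ a b) {i : Fin 3} {t : ℝ}
    (ht : t ∈ Set.Ioo (a i) (b i)) : Function.update x i t ∈ boxQ a b := by
  intro j _
  by_cases h : j = i
  · subst h; simpa using ht
  · simpa [h] using hx j trivial

lemma line_deriv {a b x : Fin 3 → ℝ} (hx : x ∈ boxQ a b) (i : Fin 3) {f : (Fin 3 → ℝ) → ℝ}
    (h : PP a b 1 f) : ∀ r ∈ Set.Ioo (a i) (b i),
      HasDerivAt (fun r => f (Function.update x i r)) (pDeriv3 f i (Function.update x i r)) r := by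
  intro r hr
  have hd : DifferentiableAt ℝ f (Function.update x i r) :=
    (h.contDiffOn.contDiffAt ((boxQ_open a b).mem_nhds (update_mem hx hr))).differentiableAt
      (by norm_num)
  exact hd.hasFDerivAt.comp_hasDerivAt r (hasDerivAt_update x i r)

lemma line_cont {a b x : Fin 3 → ℝ} (hab : ∀ i, a i < b i) (hx : x ∈ boxQ a b) (i : Fin 3)
    {f : (Fin 3 → ℝ) → ℝ} (h : PP a b 1 f) :
    ContinuousOn (fun r => pDeriv3 f i (Function.update x i r)) (Set.Ioo (a i) (b i)) := by
  have := (PP.deriv hab (n := 0) h i).contDiffOn.continuousOn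
  have hu : Continuous (fun r : ℝ => Function.update x i r) :=
    continuous_const.update i continuous_id
  exact this.comp hu.continuousOn (fun r hr => update_mem hx hr)

/-- The embedding constant in one dimension. -/
noncomputable def cc (a b : Fin 3 → ℝ) : ℝ := ∑ i, (2 / (b i - a i) + 2 * (b i - a i))

lemma cc_pos {a b : Fin 3 → ℝ} (hab : ∀ i, a i < b i) : 0 < cc a b := by
  unfold cc
  refine Finset.sum_pos (fun i _ => ?_) ⟨0, by simp⟩
  have : 0 < b i - a i := by linarith [hab i]
  positivity

lemma cc_ge {a b : Fin 3 → ℝ} (hab : ∀ i, a i < b i) (i : Fin 3) :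
    2 / (b i - a i) + 2 * (b i - a i) ≤ cc a b := by
  unfold cc
  refine Finset.single_le_sum (f := fun i => 2 / (b i - a i) + 2 * (b i - a i))
    (fun i _ => ?_) (Finset.mem_univ i)
  have : 0 < b i - a i := by linarith [hab i]
  positivity

lemma GG_step {a b : Fin 3 → ℝ} (hab : ∀ i, a i < b i) {f : (Fin 3 → ℝ) → ℝ} (h : PP a b 1 f)
    (i : Fin 3) (x : Fin 3 → ℝ) :
    GG a b f x ≤ ENNReal.ofReal (cc a b) *
      ∫⁻ t, (GG a b f (Function.update x i t) + GG a b (pDeriv3 f i) (Function.update x i t))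
        ∂(mu a b i) := by
  by_cases hx : x ∈ boxQ a b
  · have := lemA (fun r => f (Function.update x i r)) _ (a i) (b i) (x i) (hx i trivial)
      (line_deriv hx i h) (line_cont hab hx i h)
    simp only [Function.update_eq_self] at this
    rw [GG_mem f hx]
    refine this.trans ?_
    refine mul_le_mul' (ENNReal.ofReal_le_ofReal (cc_ge hab i)) ?_
    · unfold mu
      refine le_of_eq (setLIntegral_congr_fun measurableSet_Ioo (fun r hr => ?_))
      simp only [GG_mem _ (update_mem hx hr)]
  · rw [GG_notMem f hx]; exact zero_le

lemma GG_chain {a b : Fin 3 → ℝ} (hab : ∀ i, a i < b i) {f : (Fin 3 → ℝ) → ℝ} (h : PP a b 1 f)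
    (s : Finset (Fin 3)) (i : Fin 3) (hi : i ∉ s) (x : Fin 3 → ℝ) :
    lmarginal (mu a b) s (GG a b f) x ≤ ENNReal.ofReal (cc a b) *
      (lmarginal (mu a b) (insert i s) (GG a b f) x +
        lmarginal (mu a b) (insert i s) (GG a b (pDeriv3 f i)) x) := by
  have m1 := GG_meas h
  have m2 := GG_meas (PP.deriv hab (n := 0) h i)
  have e : lmarginal (mu a b) (insert i s) (GG a b f) x +
        lmarginal (mu a b) (insert i s) (GG a b (pDeriv3 f i)) x
      = lmarginal (mu a b) (insert i s) (fun y => GG a b f y + GG a b (pDeriv3 f i) y) x := by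
    unfold lmarginal
    rw [lintegral_add_left]
    exact m1.comp (by fun_prop)
  have m3 : Measurable (fun y => GG a b f y + GG a b (pDeriv3 f i) y) := m1.add m2
  rw [e, lmarginal_insert' _ m3 hi]
  refine (lmarginal_mono (GG_step hab h i) x).trans ?_
  unfold lmarginal
  rw [lintegral_const_mul' _ _ (by simp)]

/-- Total integral. -/
noncomputable def TT (a b : Fin 3 → ℝ) (f : (Fin 3 → ℝ) → ℝ) : ENNReal :=
  ∫⁻ x, GG a b f x ∂(Measure.pi (mu a b))

lemma TT_eq {a b : Fin 3 → ℝ} (hab : ∀ i, a i < b i) {n : ℕ} {f : (Fin 3 → ℝ) → ℝ}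
    (h : PP a b n f) : TT a b f = ENNReal.ofReal (∫ x in boxQ a b, f x ^ 2) := by
  have hm : Measure.pi (mu a b) = volume.restrict (boxQ a b) := by
    unfold mu boxQ
    rw [volume_pi, Measure.restrict_pi_pi]
  rw [TT, hm, ofReal_integral_eq_lintegral_ofReal (h.integrable hab)
    (Filter.Eventually.of_forall (fun _ => sq_nonneg _))]
  exact setLIntegral_congr_fun (boxQ_open a b).measurableSet (fun x hx => GG_mem f hx)

lemma GG_four {a b : Fin 3 → ℝ} (hab : ∀ i, a i < b i) {f : (Fin 3 → ℝ) → ℝ} (h : PP a b 2 f)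
    (i j k : Fin 3) (hij : j ≠ i) (hkj : k ∉ ({j, i} : Finset (Fin 3)))
    (hu : ({k, j, i} : Finset (Fin 3)) = univ) (x : Fin 3 → ℝ) :
    lmarginal (mu a b) {i} (GG a b f) x ≤ ENNReal.ofReal (cc a b) ^ 2 *
      (TT a b f + TT a b (pDeriv3 f k) + TT a b (pDeriv3 f j)
        + TT a b (pDeriv3 (pDeriv3 f j) k)) := by
  have h1 := GG_chain hab (h.mono (by norm_num)) {i} j (by simpa using hij) x
  have h2 := GG_chain hab (h.mono (by norm_num)) {j, i} k hkj x
  have h3 := GG_chain hab (PP.deriv hab (n := 1) h j) {j, i} k hkj x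
  simp only [hu, lmarginal_univ] at h2 h3
  refine h1.trans ?_
  refine (mul_le_mul_right (add_le_add h2 h3) _).trans (le_of_eq ?_)
  unfold TT
  ring

lemma GG_diff {a b : Fin 3 → ℝ} (hab : ∀ i, a i < b i) {f : (Fin 3 → ℝ) → ℝ} (h : PP a b 1 f)
    {x : Fin 3 → ℝ} (hx : x ∈ boxQ a b) (i : Fin 3) {t : ℝ} (ht : t ∈ Set.Ioo (a i) (b i)) :
    ENNReal.ofReal ((f x - f (Function.update x i t)) ^ 2) ≤
      ENNReal.ofReal |x i - t| * lmarginal (mu a b) {i} (GG a b (pDeriv3 f i)) x := by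
  have := lemB (fun r => f (Function.update x i r)) _ (a i) (b i) t (x i) ht (hx i trivial)
      (line_deriv hx i h) (line_cont hab hx i h)
  simp only [Function.update_eq_self] at this
  refine this.trans ?_
  rw [lmarginal_singleton]
  refine mul_le_mul' le_rfl ?_
  unfold mu
  refine le_of_eq (setLIntegral_congr_fun measurableSet_Ioo (fun r hr => ?_))
  simp only [GG_mem _ (update_mem hx hr)]

/-- The squared norm. -/
noncomputable def NN (a b : Fin 3 → ℝ) (u : (Fin 3 → ℝ) → ℝ) : ℝ :=
  ∫ w in boxQ a b, tildeH1Integrand3 u w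

lemma NN_eq {a b : Fin 3 → ℝ} (hab : ∀ i, a i < b i) {u : (Fin 3 → ℝ) → ℝ} (h : PP a b 3 u) :
    ENNReal.ofReal (NN a b u) = TT a b u + TT a b (pDeriv3 u 0) + TT a b (pDeriv3 u 1)
      + TT a b (pDeriv3 u 2) + TT a b (pDeriv3 (pDeriv3 u 1) 0) + TT a b (pDeriv3 (pDeriv3 u 2) 0)
      + TT a b (pDeriv3 (pDeriv3 u 2) 1) + TT a b (pDeriv3 (pDeriv3 (pDeriv3 u 2) 1) 0) := by
  have p (i) : PP a b 2 (pDeriv3 u i) := h.deriv hab i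
  have p2 (i j) : PP a b 1 (pDeriv3 (pDeriv3 u i) j) := (p i).deriv hab j
  have p3 (i j k) : PP a b 0 (pDeriv3 (pDeriv3 (pDeriv3 u i) j) k) := (p2 i j).deriv hab k
  have nn : ∀ f : (Fin 3 → ℝ) → ℝ, 0 ≤ ∫ x in boxQ a b, f x ^ 2 :=
    fun f => integral_nonneg (fun _ => sq_nonneg _)
  rw [TT_eq hab h, TT_eq hab (p _), TT_eq hab (p _), TT_eq hab (p _), TT_eq hab (p2 _ _),
    TT_eq hab (p2 _ _), TT_eq hab (p2 _ _), TT_eq hab (p3 _ _ _)]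
  have i0 := h.integrable hab
  have i1 (i) := (p i).integrable hab
  have i2 (i j) := (p2 i j).integrable hab
  have i3 (i j k) := (p3 i j k).integrable hab
  have e : NN a b u = ∫ x in boxQ a b, (u x ^ 2 + pDeriv3 u 0 x ^ 2 + pDeriv3 u 1 x ^ 2
      + pDeriv3 u 2 x ^ 2 + pDeriv3 (pDeriv3 u 1) 0 x ^ 2 + pDeriv3 (pDeriv3 u 2) 0 x ^ 2
      + pDeriv3 (pDeriv3 u 2) 1 x ^ 2 + pDeriv3 (pDeriv3 (pDeriv3 u 2) 1) 0 x ^ 2) := by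
    unfold NN
    congr 1
    ext x
    have e1 : ∀ i j, pDeriv3₂ u i j x = pDeriv3 (pDeriv3 u j) i x := fun _ _ => rfl
    have e2 : mixedDeriv3 u x = pDeriv3 (pDeriv3 (pDeriv3 u 2) 1) 0 x := rfl
    rw [tildeH1Integrand3, e1, e1, e1, e2, Fin.sum_univ_three]
    ring
  have j1 := i0.add (i1 0)
  have j2 := j1.add (i1 1)
  have j3 := j2.add (i1 2)
  have j4 := j3.add (i2 1 0)
  have j5 := j4.add (i2 2 0)
  have j6 := j5.add (i2 2 1)
  simp only [Pi.add_def] at j1 j2 j3 j4 j5 j6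
  have e' : NN a b u = (∫ x in boxQ a b, u x ^ 2) + (∫ x in boxQ a b, pDeriv3 u 0 x ^ 2)
      + (∫ x in boxQ a b, pDeriv3 u 1 x ^ 2) + (∫ x in boxQ a b, pDeriv3 u 2 x ^ 2)
      + (∫ x in boxQ a b, pDeriv3 (pDeriv3 u 1) 0 x ^ 2)
      + (∫ x in boxQ a b, pDeriv3 (pDeriv3 u 2) 0 x ^ 2)
      + (∫ x in boxQ a b, pDeriv3 (pDeriv3 u 2) 1 x ^ 2)
      + (∫ x in boxQ a b, pDeriv3 (pDeriv3 (pDeriv3 u 2) 1) 0 x ^ 2) := by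
    rw [e, ← integral_add i0 (i1 0), ← integral_add j1 (i1 1), ← integral_add j2 (i1 2),
      ← integral_add j3 (i2 1 0), ← integral_add j4 (i2 2 0), ← integral_add j5 (i2 2 1),
      ← integral_add j6 (i3 2 1 0)]
  rw [e']
  have q := nn u
  have q1 (i) := nn (pDeriv3 u i)
  have q2 (i j) := nn (pDeriv3 (pDeriv3 u i) j)
  have q3 (i j k) := nn (pDeriv3 (pDeriv3 (pDeriv3 u i) j) k)
  have r1 := add_nonneg q (q1 0)
  have r2 := add_nonneg r1 (q1 1)
  have r3 := add_nonneg r2 (q1 2)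
  have r4 := add_nonneg r3 (q2 1 0)
  have r5 := add_nonneg r4 (q2 2 0)
  have r6 := add_nonneg r5 (q2 2 1)
  rw [ENNReal.ofReal_add r6 (q3 _ _ _), ENNReal.ofReal_add r5 (q2 _ _),
    ENNReal.ofReal_add r4 (q2 _ _), ENNReal.ofReal_add r3 (q2 _ _), ENNReal.ofReal_add r2 (q1 _),
    ENNReal.ofReal_add r1 (q1 _), ENNReal.ofReal_add q (q1 _)]

lemma NN_nonneg (a b : Fin 3 → ℝ) (u : (Fin 3 → ℝ) → ℝ) : 0 ≤ NN a b u := by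
  unfold NN
  refine integral_nonneg (fun x => ?_)
  simp only [tildeH1Integrand3, Pi.zero_apply]
  positivity

lemma marg_le {a b : Fin 3 → ℝ} (hab : ∀ i, a i < b i) {u : (Fin 3 → ℝ) → ℝ} (h : PP a b 3 u)
    (i : Fin 3) (x : Fin 3 → ℝ) :
    lmarginal (mu a b) {i} (GG a b (pDeriv3 u i)) x ≤
      ENNReal.ofReal (cc a b) ^ 2 * ENNReal.ofReal (NN a b u) := by
  have p (i) : PP a b 2 (pDeriv3 u i) := h.deriv hab i
  have h2 : PP a b 2 u := h.mono (by norm_num)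
  have tc : ∀ {f g : (Fin 3 → ℝ) → ℝ}, Set.EqOn f g (boxQ a b) → TT a b f = TT a b g := by
    intro f g hfg
    rw [TT, GG_congr hfg, TT]
  have s21 := h2.symm 1 2
  have s10 := h2.symm 0 1
  have s20 := h2.symm 0 2
  have s021 := pDeriv3_congr s21 0
  have s210 : Set.EqOn (pDeriv3 (pDeriv3 (pDeriv3 u 0) 1) 2)
      (pDeriv3 (pDeriv3 (pDeriv3 u 2) 1) 0) (boxQ a b) :=
    ((pDeriv3_congr s10 2).trans ((p 1).symm 0 2)).trans s021
  rw [NN_eq hab h]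
  fin_cases i
  · refine (GG_four hab (p 0) 0 1 2 (by decide) (by decide) (by decide) x).trans ?_
    rw [tc s10, tc s20, tc s210]
    refine mul_le_mul' le_rfl (le_trans le_self_add (le_of_eq
      (?_ : _ + (TT a b u + TT a b (pDeriv3 u 1) + TT a b (pDeriv3 u 2)
        + TT a b (pDeriv3 (pDeriv3 u 2) 1)) = _)))
    ring
  · refine (GG_four hab (p 1) 1 2 0 (by decide) (by decide) (by decide) x).trans ?_
    rw [tc s21, tc s021]
    refine mul_le_mul' le_rfl (le_trans le_self_add (le_of_eq
      (?_ : _ + (TT a b u + TT a b (pDeriv3 u 0) + TT a b (pDeriv3 u 2)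
        + TT a b (pDeriv3 (pDeriv3 u 2) 0)) = _)))
    ring
  · refine (GG_four hab (p 2) 2 1 0 (by decide) (by decide) (by decide) x).trans ?_
    refine mul_le_mul' le_rfl (le_trans le_self_add (le_of_eq
      (?_ : _ + (TT a b u + TT a b (pDeriv3 u 0) + TT a b (pDeriv3 u 1)
        + TT a b (pDeriv3 (pDeriv3 u 1) 0)) = _)))
    ring

lemma sup_sq {a b : Fin 3 → ℝ} (hab : ∀ i, a i < b i) {u : (Fin 3 → ℝ) → ℝ} (h : PP a b 3 u)
    {x : Fin 3 → ℝ} (hx : x ∈ boxQ a b) : u x ^ 2 ≤ cc a b ^ 3 * NN a b u := by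
  have hc := (cc_pos hab).le
  rw [← ENNReal.ofReal_le_ofReal_iff (by have := NN_nonneg a b u; positivity),
    ENNReal.ofReal_mul (by positivity), ENNReal.ofReal_pow hc, NN_eq hab h, ← GG_mem u hx]
  have h1 := GG_chain hab (h.mono (by norm_num)) ∅ 2 (by simp) x
  simp only [lmarginal_empty, insert_empty_eq] at h1
  have h2 := GG_four hab (h.mono (by norm_num)) 2 1 0 (by decide) (by decide) (by decide) x
  have h3 := GG_four hab (h.deriv hab 2) 2 1 0 (by decide) (by decide) (by decide) x
  refine h1.trans ((mul_le_mul' le_rfl (add_le_add h2 h3)).trans (le_of_eq ?_))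
  ring

lemma diff_sq {a b : Fin 3 → ℝ} (hab : ∀ i, a i < b i) {u : (Fin 3 → ℝ) → ℝ} (h : PP a b 3 u)
    {x : Fin 3 → ℝ} (hx : x ∈ boxQ a b) (i : Fin 3) {t : ℝ} (ht : t ∈ Set.Ioo (a i) (b i)) :
    |u x - u (Function.update x i t)| ≤ cc a b * √(NN a b u) * √|x i - t| := by
  have hc := (cc_pos hab).le
  have hN := NN_nonneg a b u
  have key : (u x - u (Function.update x i t)) ^ 2 ≤ |x i - t| * (cc a b ^ 2 * NN a b u) := by
    rw [← ENNReal.ofReal_le_ofReal_iff (by positivity),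
      ENNReal.ofReal_mul (by positivity), ENNReal.ofReal_mul (by positivity),
      ENNReal.ofReal_pow hc]
    exact (GG_diff hab (h.mono (by norm_num)) hx i ht).trans (mul_le_mul' le_rfl (marg_le hab h i x))
  apply abs_le_of_sq_le_sq _ (by positivity)
  refine key.trans (le_of_eq ?_)
  rw [mul_pow, mul_pow, Real.sq_sqrt hN, Real.sq_sqrt (abs_nonneg _)]
  ring

lemma holder_open {a b : Fin 3 → ℝ} (hab : ∀ i, a i < b i) {u : (Fin 3 → ℝ) → ℝ} (h : PP a b 3 u)
    {x y : Fin 3 → ℝ} (hx : x ∈ boxQ a b) (hy : y ∈ boxQ a b) :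
    |u x - u y| ≤ 3 * cc a b * √(NN a b u) * √(√(∑ i, (x i - y i) ^ 2)) := by
  set x1 := Function.update x 0 (y 0) with hx1
  set x2 := Function.update x1 1 (y 1) with hx2
  have m1 : x1 ∈ boxQ a b := update_mem hx (hy 0 trivial)
  have m2 : x2 ∈ boxQ a b := update_mem m1 (hy 1 trivial)
  have e3 : Function.update x2 2 (y 2) = y := by
    ext j
    fin_cases j <;> simp [hx1, hx2, Function.update_apply]
  have d0 := diff_sq hab h hx 0 (hy 0 trivial)
  have d1 := diff_sq hab h m1 1 (hy 1 trivial)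
  have d2 := diff_sq hab h m2 2 (hy 2 trivial)
  rw [e3] at d2
  rw [← hx1] at d0
  rw [← hx2] at d1
  have v1 : x1 1 = x 1 := by simp [hx1, Function.update_apply]
  have v2 : x2 2 = x 2 := by simp [hx1, hx2, Function.update_apply]
  rw [v1] at d1
  rw [v2] at d2
  have hc := (cc_pos hab).le
  have hw : ∀ i, √|x i - y i| ≤ √(√(∑ i, (x i - y i) ^ 2)) := by
    intro i
    apply Real.sqrt_le_sqrt
    apply Real.abs_le_sqrt
    exact Finset.single_le_sum (f := fun i => (x i - y i) ^ 2) (fun i _ => sq_nonneg _)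
      (Finset.mem_univ i)
  have hcn : 0 ≤ cc a b * √(NN a b u) := by positivity
  have g0 := mul_le_mul_of_nonneg_left (hw 0) hcn
  have g1 := mul_le_mul_of_nonneg_left (hw 1) hcn
  have g2 := mul_le_mul_of_nonneg_left (hw 2) hcn
  have tri : |u x - u y| ≤ |u x - u x1| + |u x1 - u x2| + |u x2 - u y| := by
    have := abs_add_three (u x - u x1) (u x1 - u x2) (u x2 - u y)
    rwa [show u x - u x1 + (u x1 - u x2) + (u x2 - u y) = u x - u y by ring] at this
  linarith

/-- **Hölder embedding of the anisotropic Sobolev space `H̃¹` in 3D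
(Lemma 4.9, first embedding, on a box):** there exists `C > 0` depending only on the
box `Q` such that every `u ∈ C³(cl Q)` satisfies
`|u(x) − u(y)| ≤ C N(u) |x−y|^{1/2}` on `cl Q` and `sup_{cl Q} |u| ≤ C N(u)`. -/
theorem holder_embedding_tildeH1_3D
    (a b : Fin 3 → ℝ) (hab : ∀ i, a i < b i)
    (Q : Set (Fin 3 → ℝ)) (hQ : Q = Set.univ.pi fun i => Set.Ioo (a i) (b i)) :
    ∃ C : ℝ, 0 < C ∧ ∀ u : (Fin 3 → ℝ) → ℝ, ContDiffOn ℝ 3 u (closure Q) →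
      (∀ x ∈ closure Q, ∀ y ∈ closure Q,
        |u x - u y|
          ≤ C * Real.sqrt (∫ w in Q, tildeH1Integrand3 u w)
            * Real.sqrt (Real.sqrt (∑ i, (x i - y i) ^ 2)))
      ∧ ∀ x ∈ closure Q,
          |u x| ≤ C * Real.sqrt (∫ w in Q, tildeH1Integrand3 u w) := by
  have hc := cc_pos hab
  have hQ' : Q = boxQ a b := hQ
  subst hQ'
  refine ⟨3 * cc a b + √(cc a b ^ 3), by positivity, fun u hu => ?_⟩
  have hP : PP a b 3 u := ⟨u, hu, fun _ _ => rfl⟩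
  have hN : 0 ≤ √(NN a b u) := Real.sqrt_nonneg _
  change (∀ x ∈ closure (boxQ a b), ∀ y ∈ closure (boxQ a b), |u x - u y|
          ≤ (3 * cc a b + √(cc a b ^ 3)) * √(NN a b u) * √(√(∑ i, (x i - y i) ^ 2)))
      ∧ ∀ x ∈ closure (boxQ a b), |u x| ≤ (3 * cc a b + √(cc a b ^ 3)) * √(NN a b u)
  have hcont := hu.continuousOn
  have hs : 0 ≤ √(cc a b ^ 3) := Real.sqrt_nonneg _
  have h0 : ∀ x ∈ boxQ a b, ∀ y ∈ boxQ a b, |u x - u y|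
          ≤ (3 * cc a b + √(cc a b ^ 3)) * √(NN a b u) * √(√(∑ i, (x i - y i) ^ 2)) := by
    intro x hx y hy
    refine (holder_open hab hP hx hy).trans ?_
    gcongr
    linarith
  constructor
  · have h1 : ∀ x ∈ boxQ a b, ∀ y ∈ closure (boxQ a b), |u x - u y|
          ≤ (3 * cc a b + √(cc a b ^ 3)) * √(NN a b u) * √(√(∑ i, (x i - y i) ^ 2)) := by
      intro x hx
      refine le_on_closure (h0 x hx) (continuousOn_const.sub hcont).abs ?_
      exact Continuous.continuousOn (by fun_prop)
    intro x hx y hy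
    refine le_on_closure (f := fun x => |u x - u y|) (fun x hx => h1 x hx y hy)
      (hcont.sub continuousOn_const).abs ?_ hx
    exact Continuous.continuousOn (by fun_prop)
  · refine le_on_closure (fun x hx => ?_) hcont.abs continuousOn_const
    apply abs_le_of_sq_le_sq _ (by positivity)
    refine (sup_sq hab hP hx).trans ?_
    rw [mul_pow, Real.sq_sqrt (NN_nonneg a b u)]
    refine mul_le_mul_of_nonneg_right ?_ (NN_nonneg a b u)
    have := Real.sq_sqrt (show 0 ≤ cc a b ^ 3 by positivity)
    nlinarith
end
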